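/- Let X be a finite-dimensional strictly convex real normed linear space of dimension at least 1. Then there exists δ > 1/2 such that for all unit vectors x, y in X with x ⊥_B y (i.e. ‖x + λy‖ ≥ 1 for all real λ) and all real λ, one has ‖y + λx‖ ≥ δ. -/

import Mathlib

/-- If a unit vector `x` is Birkhoff-James orthogonal to `y`, then `|l| ≤ ‖y + l • x‖`. -/
theorem abs_le_norm_add_smul_of_orthogonal {X : Type*} [NormedAddCommGroup X] [NormedSpace ℝ X]
    {x y : X} (h : ∀ l : ℝ, 1 ≤ ‖x + l • y‖) (l : ℝ) : |l| ≤ ‖y + l • x‖ := by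
  rcases eq_or_ne l 0 with rfl | hl
  · simp
  · have key : y + l • x = l • (x + l⁻¹ • y) := by
      rw [smul_add, smul_inv_smul₀ hl, add_comm]
    rw [key, norm_smul, Real.norm_eq_abs]
    exact le_mul_of_one_le_right (abs_nonneg l) (h l⁻¹)

theorem half_lt_norm_add_smul_of_orthogonal {X : Type*} [NormedAddCommGroup X] [NormedSpace ℝ X]
    [StrictConvexSpace ℝ X] {x y : X} (hx : ‖x‖ = 1) (hy : ‖y‖ = 1)
    (h : ∀ l : ℝ, 1 ≤ ‖x + l • y‖) (l : ℝ) : (1 : ℝ) / 2 < ‖y + l • x‖ := by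
  by_contra! hle
  have habs := abs_le_norm_add_smul_of_orthogonal h l
  have hnorm : ‖-(l • x)‖ = |l| := by rw [norm_neg, norm_smul, hx, mul_one, Real.norm_eq_abs]
  have hsum : (y + l • x) + -(l • x) = y := add_neg_cancel_right _ _
  have htri := norm_add_le (y + l • x) (-(l • x))
  rw [hsum, hy, hnorm] at htri
  have heq : y + l • x = -(l • x) := by
    apply eq_of_norm_eq_of_norm_add_eq
    · rw [hnorm]; linarith
    · rw [hsum, hy, hnorm]; linarith
  have hl : l ≠ 0 := abs_pos.mp (by linarith)
  have hy' : y = (-(2 * l)) • x := by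
    rw [eq_sub_of_add_eq heq]; module
  have hzero : x + (2 * l)⁻¹ • y = 0 := by
    rw [hy', neg_smul, smul_neg, inv_smul_smul₀ (mul_ne_zero two_ne_zero hl), add_neg_cancel]
  have := h (2 * l)⁻¹
  rw [hzero, norm_zero] at this
  linarith

/-- In a finite-dimensional strictly convex real normed linear space of dimension ≥ 1,
there is a uniform δ > 1/2 with ‖y + λx‖ ≥ δ for all unit x, y with x ⊥_B y
and all real λ. -/
theorem stmt_12 (X : Type*) [NormedAddCommGroup X] [NormedSpace ℝ X]
    [FiniteDimensional ℝ X] [StrictConvexSpace ℝ X]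
    (hdim : 1 ≤ Module.finrank ℝ X) :
    ∃ δ : ℝ, (1 : ℝ) / 2 < δ ∧
      ∀ x y : X, ‖x‖ = 1 → ‖y‖ = 1 → (∀ l : ℝ, 1 ≤ ‖x + l • y‖) →
        ∀ l : ℝ, δ ≤ ‖y + l • x‖ := by
  let K : Set (X × X × ℝ) :=
    {p | ‖p.1‖ = 1 ∧ ‖p.2.1‖ = 1 ∧ (∀ l : ℝ, 1 ≤ ‖p.1 + l • p.2.1‖) ∧ |p.2.2| ≤ 1}
  have hclosed : IsClosed K := by
    simp only [K, Set.ofPred_and, Set.ofPred_forall]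
    refine (isClosed_eq (by fun_prop) (by fun_prop)).inter
      ((isClosed_eq (by fun_prop) (by fun_prop)).inter ((isClosed_iInter fun l => ?_).inter
        (isClosed_le (by fun_prop) (by fun_prop))))
    exact isClosed_le (by fun_prop) (by fun_prop)
  have : ProperSpace X := FiniteDimensional.proper ℝ X
  have hK : IsCompact K := by
    refine (isCompact_closedBall (0 : X × X × ℝ) 1).of_isClosed_subset hclosed ?_
    rintro ⟨x, y, l⟩ ⟨hx, hy, -, hl⟩
    rw [mem_closedBall_zero_iff, Prod.norm_def, Prod.norm_def]
    exact max_le hx.le (max_le hy.le hl)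
  have hlarge {x y : X} (h : ∀ l : ℝ, 1 ≤ ‖x + l • y‖) {l : ℝ} (hl : ¬|l| ≤ 1) :
      1 ≤ ‖y + l • x‖ :=
    (not_le.mp hl).le.trans (abs_le_norm_add_smul_of_orthogonal h l)
  rcases K.eq_empty_or_nonempty with hempty | hne
  · refine ⟨1, by norm_num, fun x y hx hy h l => hlarge h fun hl => ?_⟩
    exact hempty.subset (show (x, y, l) ∈ K from ⟨hx, hy, h, hl⟩)
  · obtain ⟨p, hp, hmin⟩ := hK.exists_isMinOn hne
      (f := fun p : X × X × ℝ => ‖p.2.1 + p.2.2 • p.1‖) (by fun_prop)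
    refine ⟨min 1 ‖p.2.1 + p.2.2 • p.1‖, lt_min (by norm_num)
      (half_lt_norm_add_smul_of_orthogonal hp.1 hp.2.1 hp.2.2.1 _), fun x y hx hy h l => ?_⟩
    by_cases hl : |l| ≤ 1
    · exact (min_le_right _ _).trans (hmin (show (x, y, l) ∈ K from ⟨hx, hy, h, hl⟩))
    · exact (min_le_left _ _).trans (hlarge h hl)
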